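/- In the Setup, if two points x and y of a piece P have the same c*_X-color and can be connected by an r-chain of points of that c*_X-color in X, then d(x, y) ≤ 36·f(r). -/

import Mathlib

open Set Metric

section Core

variable {X : Type*} [MetricSpace X]

/-- A geodesic segment parametrized by the interval `[a, b]`:
an isometric embedding of `[a, b]` into `X`. -/
def IsGeodesicSegment (γ : ℝ → X) (a b : ℝ) : Prop :=
  ∀ s ∈ Set.Icc a b, ∀ t ∈ Set.Icc a b, dist (γ s) (γ t) = |s - t|

/-- A metric space is geodesic if every two points are joined by a geodesic. -/
def GeodesicSpace (X : Type*) [MetricSpace X] : Prop :=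
  ∀ x y : X, ∃ γ : ℝ → X, IsGeodesicSegment γ 0 (dist x y) ∧ γ 0 = x ∧ γ (dist x y) = y

/-- A subset is geodesic if every two of its points are joined by a geodesic of `X`
contained in the subset. -/
def IsGeodesicSubset (S : Set X) : Prop :=
  ∀ x ∈ S, ∀ y ∈ S, ∃ γ : ℝ → X, IsGeodesicSegment γ 0 (dist x y) ∧ γ 0 = x ∧
    γ (dist x y) = y ∧ ∀ t ∈ Set.Icc (0 : ℝ) (dist x y), γ t ∈ S

/-- A (complete geodesic) metric space is tree-graded with respect to a collection `PX`
of closed geodesic subsets (pieces) covering `X` if every two different pieces meet in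
at most one point (T₁) and every simple loop (injective continuous image of a circle)
is contained in one piece (T₂''). -/
structure IsTreeGraded (X : Type*) [MetricSpace X] (PX : Set (Set X)) : Prop where
  nonempty : ∀ P ∈ PX, P.Nonempty
  closed : ∀ P ∈ PX, IsClosed P
  geodesicSub : ∀ P ∈ PX, IsGeodesicSubset P
  covers : ∀ x : X, ∃ P ∈ PX, x ∈ P
  t1 : ∀ P ∈ PX, ∀ Q ∈ PX, P ≠ Q → (P ∩ Q).Subsingleton
  t2 : ∀ loop : AddCircle (1 : ℝ) → X, Continuous loop → Function.Injective loop →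
    ∃ P ∈ PX, Set.range loop ⊆ P

end Core
section Chains

variable {Y : Type*}

/-- An `r`-chain from `x` to `y` inside the set `S`, with respect to the distance
function `d`: a finite sequence `x = c 0, c 1, …, c m = y` of points of `S` with
consecutive distances `< r`. -/
def IsDChain (d : Y → Y → ℝ) (r : ℝ) (S : Set Y) (x y : Y) : Prop :=
  ∃ (m : ℕ) (c : ℕ → Y), c 0 = x ∧ c m = y ∧ (∀ i ≤ m, c i ∈ S) ∧
    ∀ i < m, d (c i) (c (i + 1)) < r

/-- A set is `r`-scale connected if every two of its points are joined by an
`r`-chain contained in it. -/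
def DScaleConnected (d : Y → Y → ℝ) (r : ℝ) (S : Set Y) : Prop :=
  ∀ x ∈ S, ∀ y ∈ S, IsDChain d r S x y

/-- `C` is an `r`-scale connected component of `U`: a maximal `r`-scale connected
subset of `U`. -/
def IsDComponent (d : Y → Y → ℝ) (r : ℝ) (U C : Set Y) : Prop :=
  C ⊆ U ∧ DScaleConnected d r C ∧
    ∀ C', C ⊆ C' → C' ⊆ U → DScaleConnected d r C' → C = C'

/-- A set is `M`-bounded: its diameter is at most `M`. -/
def DBounded (d : Y → Y → ℝ) (M : ℝ) (S : Set Y) : Prop :=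
  ∀ x ∈ S, ∀ y ∈ S, d x y ≤ M

/-- A space has dimension `≤ n` at scale `s` of magnitude `M` if there is a cover by
`n + 1` sets such that every `s`-scale connected component of each of them is
`M`-bounded. -/
def DimLeAtScale (d : Y → Y → ℝ) (n : ℕ) (s M : ℝ) : Prop :=
  ∃ U : Fin (n + 1) → Set Y, (∀ y, ∃ i, y ∈ U i) ∧
    ∀ i C, IsDComponent d s (U i) C → DBounded d M C

end Chains
section TreeGradedColoring

variable {X : Type*} [MetricSpace X]

/-- The `r`-scale connected component `𝔠_P` of `c_P`-color `0` of the piece `P`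
containing its base point `x_P = proj P x̂`: the set of points of `P` reachable from
`x_P` by an `r`-chain of points of `P` of `c_P`-color `0`. -/
def pieceComp (r : ℝ) {n : ℕ} (xhat : X) (proj : Set X → X → X)
    (cP : Set X → X → Fin (n + 1)) (P : Set X) : Set X :=
  {y | IsDChain dist r {z | z ∈ P ∧ cP P z = 0} (proj P xhat) y}

/-- `P` is a long piece of the geodesic `γ : [0, L] → X` (from `x̂` to `x = γ L`):
`γ` meets `P` and the exit point `π_P x` does not belong to `𝔠_P`. -/
def IsLongPiece (PX : Set (Set X)) (r : ℝ) {n : ℕ} (xhat : X)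
    (proj : Set X → X → X) (cP : Set X → X → Fin (n + 1))
    (γ : ℝ → X) (L : ℝ) (P : Set X) : Prop :=
  P ∈ PX ∧ (∃ t ∈ Set.Icc 0 L, γ t ∈ P) ∧
    proj P (γ L) ∉ pieceComp r xhat proj cP P

/-- The parameter at which the geodesic `γ : [0, L] → X` enters the piece `P`. -/
noncomputable def pieceStart (γ : ℝ → X) (L : ℝ) (P : Set X) : ℝ :=
  sInf {t | t ∈ Set.Icc 0 L ∧ γ t ∈ P}

/-- The parameter at which the geodesic `γ : [0, L] → X` exits the piece `P`. -/
noncomputable def pieceEnd (γ : ℝ → X) (L : ℝ) (P : Set X) : ℝ :=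
  sSup {t | t ∈ Set.Icc 0 L ∧ γ t ∈ P}

/-- The complement in `γ : [0, L] → X` (in parameter space) of the interiors of all
reduced long pieces of `γ`; its connected components are the subpaths `β₁, …, β_k`. -/
noncomputable def betaSet (PX : Set (Set X)) (r : ℝ) {n : ℕ} (xhat : X)
    (proj : Set X → X → X) (cP : Set X → X → Fin (n + 1))
    (γ : ℝ → X) (L : ℝ) : Set ℝ :=
  Set.Icc 0 L \
    ⋃ P ∈ {P | IsLongPiece PX r xhat proj cP γ L P},
      Set.Ioo (pieceStart γ L P + r / 2) (pieceEnd γ L P)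

/-- The length `|⌊β⌋|` of the initial part of the subpath `β = γ|[a,b]`, where
`⌊β⌋` goes from `β₋ = γ a` to the entry point `β′` of the piece of the induced
tree-graded structure on `β` containing `β₊ = γ b`. -/
noncomputable def floorLen (PX : Set (Set X)) (γ : ℝ → X) (a b : ℝ) : ℝ :=
  sInf {t | t ∈ Set.Icc a b ∧ ∃ P ∈ PX, γ '' Set.Icc t b ⊆ P} - a

/-- `v` is the value at `x = γ L` of the coloring `c*_X` computed along the geodesic
`γ : [0, L] → X` from `x̂` to `x`:
`v = Σ_P c_P(π_P x) + Σᵢ ⌊ |⌊βᵢ⌋| / (99 f(r)) ⌋ (mod n+1)`,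
where the first sum is over the (finitely many) pieces with a nonzero term and
`β₁, …, β_k` are the connected components of the complement in `γ` of the interiors
of the reduced long pieces of `γ`. -/
def ColorValue (PX : Set (Set X)) (r fr : ℝ) {n : ℕ} (xhat : X)
    (proj : Set X → X → X) (cP : Set X → X → Fin (n + 1))
    (γ : ℝ → X) (L : ℝ) (v : Fin (n + 1)) : Prop :=
  ∃ (Ps : Finset (Set X)) (k : ℕ) (a b : Fin k → ℝ),
    (↑Ps : Set (Set X)) = {P | P ∈ PX ∧ cP P (proj P (γ L)) ≠ 0} ∧
    (∀ i, a i ≤ b i) ∧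
    (betaSet PX r xhat proj cP γ L = ⋃ i, Set.Icc (a i) (b i)) ∧
    (∀ i j, i ≠ j → b i < a j ∨ b j < a i) ∧
    (v : ℕ) =
      ((Ps.sum fun P => ((cP P (proj P (γ L)) : ℕ))) +
        (Finset.univ.sum fun i : Fin k =>
          Nat.floor (floorLen PX γ (a i) (b i) / (99 * fr)))) % (n + 1)

/-- The Setup: `X` is a geodesic metric space, tree-graded with respect to `PX`, pieces
do not contain other pieces; `n` is a positive integer, `r > 0` and `f(r) ≥ r`;
`proj P` is the nearest-point projection onto the piece `P`; `x̂` is a base point and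
`x_P = proj P x̂`; `c_P` is a coloring of each piece `P` by `n + 1` colors such that
`r`-components of every nonzero color are `f(r)`-bounded, `r`-components of color `0`
are `8 f(r)`-bounded, and `c_P` vanishes on the closed ball `B(x_P, 2r)`. -/
structure ColoringSetup (X : Type*) [MetricSpace X] (PX : Set (Set X)) (n : ℕ)
    (r fr : ℝ) (xhat : X) (proj : Set X → X → X)
    (cP : Set X → X → Fin (n + 1)) : Prop where
  geodesic : GeodesicSpace X
  treeGraded : IsTreeGraded X PX
  noPieceContainsPiece : ∀ P ∈ PX, ∀ Q ∈ PX, P ⊆ Q → P = Q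
  npos : 0 < n
  rpos : 0 < r
  rlefr : r ≤ fr
  projMem : ∀ P ∈ PX, ∀ x : X, proj P x ∈ P
  projDist : ∀ P ∈ PX, ∀ x : X, dist x (proj P x) = Metric.infDist x P
  ballZero : ∀ P ∈ PX, ∀ y ∈ P, dist y (proj P xhat) ≤ 2 * r → cP P y = 0
  nonzeroBounded : ∀ P ∈ PX, ∀ j : Fin (n + 1), j ≠ 0 →
    ∀ x y : X, IsDChain dist r {z | z ∈ P ∧ cP P z = j} x y → dist x y ≤ fr
  zeroBounded : ∀ P ∈ PX, ∀ x y : X,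
    IsDChain dist r {z | z ∈ P ∧ cP P z = 0} x y → dist x y ≤ 8 * fr

end TreeGradedColoring

section Arcs

variable {X : Type*}

/-- Follow `f` up to time `a`, then `g`. -/
noncomputable def concat (f g : ℝ → X) (a : ℝ) : ℝ → X :=
  fun t => if t ≤ a then f t else g (t - a)

theorem concat_of_le {f g : ℝ → X} {a t : ℝ} (h : t ≤ a) : concat f g a t = f t := by
  simp [concat, h]

theorem concat_of_ge {f g : ℝ → X} {a t : ℝ} (hfg : f a = g 0) (h : a ≤ t) :
    concat f g a t = g (t - a) := by
  rcases h.eq_or_lt with rfl | h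
  · simp [concat, hfg]
  · simp [concat, not_le.2 h]

theorem concat_image {f g : ℝ → X} {a b : ℝ} (hfg : f a = g 0) (ha : 0 ≤ a) (hb : 0 ≤ b) :
    concat f g a '' Icc 0 (a + b) = f '' Icc 0 a ∪ g '' Icc 0 b := by
  rw [← Icc_union_Icc_eq_Icc ha (le_add_of_nonneg_right hb), image_union]
  congr 1
  · exact image_congr fun t ht => concat_of_le ht.2
  · ext y
    constructor
    · rintro ⟨t, ht, rfl⟩
      exact ⟨t - a, ⟨by linarith [ht.1], by linarith [ht.2]⟩, (concat_of_ge hfg ht.1).symm⟩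
    · rintro ⟨t, ht, rfl⟩
      refine ⟨a + t, ⟨by linarith [ht.1], by linarith [ht.2]⟩, ?_⟩
      rw [concat_of_ge hfg (by linarith [ht.1]), add_sub_cancel_left]

variable [MetricSpace X]

/-- `A` is an arc from `p` to `q`: an injective continuous image of a (possibly degenerate)
interval. -/
def IsArc (A : Set X) (p q : X) : Prop :=
  ∃ (L : ℝ) (f : ℝ → X), 0 ≤ L ∧ ContinuousOn f (Icc 0 L) ∧ InjOn f (Icc 0 L) ∧
    f 0 = p ∧ f L = q ∧ f '' Icc 0 L = A

theorem concat_continuousOn {f g : ℝ → X} {a b : ℝ} (hfg : f a = g 0)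
    (hf : ContinuousOn f (Icc 0 a)) (hg : ContinuousOn g (Icc 0 b)) (ha : 0 ≤ a) (hb : 0 ≤ b) :
    ContinuousOn (concat f g a) (Icc 0 (a + b)) := by
  rw [← Icc_union_Icc_eq_Icc ha (le_add_of_nonneg_right hb)]
  refine ContinuousOn.union_of_isClosed ?_ ?_ isClosed_Icc isClosed_Icc
  · exact hf.congr fun t ht => concat_of_le ht.2
  · refine ContinuousOn.congr (f := fun t => g (t - a)) ?_ fun t ht => concat_of_ge hfg ht.1
    exact hg.comp (by fun_prop) fun t ht => ⟨by linarith [ht.1], by linarith [ht.2]⟩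

theorem IsArc.symm {A : Set X} {p q : X} (h : IsArc A p q) : IsArc A q p := by
  obtain ⟨L, f, hL, hc, hi, h0, h1, hA⟩ := h
  have hmaps : MapsTo (fun t : ℝ => L - t) (Icc 0 L) (Icc 0 L) :=
    fun t ht => ⟨by linarith [ht.2], by linarith [ht.1]⟩
  refine ⟨L, fun t => f (L - t), hL, hc.comp (by fun_prop) hmaps, ?_, by simpa, by simpa, ?_⟩
  · intro s hs t ht hst
    linarith [hi (hmaps hs) (hmaps ht) hst]
  · rw [← hA]
    ext y
    constructor
    · rintro ⟨t, ht, rfl⟩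
      exact ⟨L - t, hmaps ht, rfl⟩
    · rintro ⟨t, ht, rfl⟩
      exact ⟨L - t, hmaps ht, by simp⟩

theorem IsArc.trans {A B : Set X} {p q s : X} (hA : IsArc A p q) (hB : IsArc B q s)
    (hAB : A ∩ B ⊆ {q}) : IsArc (A ∪ B) p s := by
  obtain ⟨a, f, ha, hfc, hfi, hf0, hf1, rfl⟩ := hA
  obtain ⟨b, g, hb, hgc, hgi, hg0, hg1, rfl⟩ := hB
  have hfg : f a = g 0 := hf1.trans hg0.symm
  refine ⟨a + b, concat f g a, by linarith, concat_continuousOn hfg hfc hgc ha hb, ?_, ?_, ?_,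
    concat_image hfg ha hb⟩
  · have key : ∀ u ∈ Icc 0 a, ∀ v ∈ Icc a (a + b), concat f g a u = concat f g a v → u = v := by
      intro u hu v hv huv
      rw [concat_of_le hu.2, concat_of_ge hfg hv.1] at huv
      have hv' : v - a ∈ Icc 0 b := ⟨by linarith [hv.1], by linarith [hv.2]⟩
      have hq : f u = q := hAB ⟨⟨u, hu, rfl⟩, ⟨v - a, hv', huv.symm⟩⟩
      have h1 := hfi hu ⟨ha, le_rfl⟩ (hq.trans hf1.symm)
      have h2 := hgi hv' ⟨le_rfl, hb⟩ ((huv.symm.trans hq).trans hg0.symm)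
      linarith
    intro u hu v hv huv
    rcases le_total u a with h1 | h1 <;> rcases le_total v a with h2 | h2
    · rw [concat_of_le h1, concat_of_le h2] at huv
      exact hfi ⟨hu.1, h1⟩ ⟨hv.1, h2⟩ huv
    · exact key u ⟨hu.1, h1⟩ v ⟨h2, hv.2⟩ huv
    · exact (key v ⟨hv.1, h2⟩ u ⟨h1, hu.2⟩ huv.symm).symm
    · rw [concat_of_ge hfg h1, concat_of_ge hfg h2] at huv
      have := hgi ⟨sub_nonneg.2 h1, by linarith [hu.2]⟩ ⟨sub_nonneg.2 h2, by linarith [hv.2]⟩ huv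
      linarith
  · rw [concat_of_le ha, hf0]
  · rw [concat_of_ge hfg (by linarith), add_sub_cancel_left, hg1]

theorem IsGeodesicSegment.mono {γ : ℝ → X} {a b c d : ℝ} (h : IsGeodesicSegment γ a b)
    (hac : a ≤ c) (hdb : d ≤ b) : IsGeodesicSegment γ c d :=
  fun s hs t ht => h s ⟨hac.trans hs.1, hs.2.trans hdb⟩ t ⟨hac.trans ht.1, ht.2.trans hdb⟩

theorem IsGeodesicSegment.injOn {γ : ℝ → X} {a b : ℝ} (h : IsGeodesicSegment γ a b) :
    InjOn γ (Icc a b) := by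
  intro s hs t ht hst
  have := h s hs t ht
  rw [hst, dist_self] at this
  linarith [abs_eq_zero.1 this.symm]

theorem IsGeodesicSegment.continuousOn {γ : ℝ → X} {a b : ℝ} (h : IsGeodesicSegment γ a b) :
    ContinuousOn γ (Icc a b) := by
  refine LipschitzOnWith.continuousOn (K := 1) (LipschitzOnWith.of_dist_le_mul ?_)
  intro s hs t ht
  rw [h s hs t ht, NNReal.coe_one, one_mul, Real.dist_eq]

theorem IsGeodesicSegment.isArc {γ : ℝ → X} {a b : ℝ} (h : IsGeodesicSegment γ a b)
    (hab : a ≤ b) : IsArc (γ '' Icc a b) (γ a) (γ b) := by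
  have hmaps : MapsTo (fun t : ℝ => a + t) (Icc 0 (b - a)) (Icc a b) :=
    fun t ht => ⟨by linarith [ht.1], by linarith [ht.2]⟩
  refine ⟨b - a, fun t => γ (a + t), sub_nonneg.2 hab, h.continuousOn.comp (by fun_prop) hmaps,
    ?_, by simp, by simp, ?_⟩
  · intro s hs t ht hst
    linarith [h.injOn (hmaps hs) (hmaps ht) hst]
  · ext y
    constructor
    · rintro ⟨t, ht, rfl⟩
      exact ⟨a + t, hmaps ht, rfl⟩
    · rintro ⟨t, ht, rfl⟩
      exact ⟨t - a, ⟨by linarith [ht.1], by linarith [ht.2]⟩, by simp⟩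

theorem IsGeodesicSegment.isArc_uIcc {γ : ℝ → X} {a b s t : ℝ} (h : IsGeodesicSegment γ a b)
    (hs : s ∈ Icc a b) (ht : t ∈ Icc a b) : IsArc (γ '' uIcc s t) (γ s) (γ t) := by
  rcases le_total s t with hst | hst
  · rw [uIcc_of_le hst]
    exact (h.mono hs.1 ht.2).isArc hst
  · rw [uIcc_of_ge hst]
    exact ((h.mono ht.1 hs.2).isArc hst).symm

theorem IsGeodesicSegment.concat {f g : ℝ → X} {a b : ℝ} (hf : IsGeodesicSegment f 0 a)
    (hg : IsGeodesicSegment g 0 b) (hfg : f a = g 0) (ha : 0 ≤ a) (hb : 0 ≤ b)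
    (hd : dist (f 0) (g b) = a + b) : IsGeodesicSegment (concat f g a) 0 (a + b) := by
  have key : ∀ u ∈ Icc 0 a, ∀ v ∈ Icc a (a + b),
      dist (_root_.concat f g a u) (_root_.concat f g a v) = v - u := by
    intro u hu v hv
    have hv' : v - a ∈ Icc 0 b := ⟨by linarith [hv.1], by linarith [hv.2]⟩
    rw [concat_of_le hu.2, concat_of_ge hfg hv.1]
    have h1 := hf 0 ⟨le_rfl, ha⟩ u hu
    have h2 := hf u hu a ⟨ha, le_rfl⟩
    have h3 := hg 0 ⟨le_rfl, hb⟩ (v - a) hv'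
    have h4 := hg (v - a) hv' b ⟨hb, le_rfl⟩
    rw [abs_of_nonpos (by linarith [hu.1])] at h1
    rw [abs_of_nonpos (by linarith [hu.2])] at h2
    rw [abs_of_nonpos (by linarith [hv.1])] at h3
    rw [abs_of_nonpos (by linarith [hv.2])] at h4
    have t1 := dist_triangle4 (f 0) (f u) (g (v - a)) (g b)
    have t2 := dist_triangle (f u) (f a) (g (v - a))
    rw [hfg] at t2 h2
    linarith
  intro u hu v hv
  rcases le_total u a with h1 | h1 <;> rcases le_total v a with h2 | h2
  · rw [concat_of_le h1, concat_of_le h2]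
    exact hf u ⟨hu.1, h1⟩ v ⟨hv.1, h2⟩
  · rw [key u ⟨hu.1, h1⟩ v ⟨h2, hv.2⟩, abs_sub_comm, abs_of_nonneg (by linarith)]
  · rw [dist_comm, key v ⟨hv.1, h2⟩ u ⟨h1, hu.2⟩, abs_of_nonneg (by linarith)]
  · rw [concat_of_ge hfg h1, concat_of_ge hfg h2,
      hg _ ⟨sub_nonneg.2 h1, by linarith [hu.2]⟩ _ ⟨sub_nonneg.2 h2, by linarith [hv.2]⟩]
    congr 1
    ring

theorem IsArc.exists_piece_of_loop {PX : Set (Set X)} (hT : IsTreeGraded X PX)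
    {A B : Set X} {p q : X} (hA : IsArc A p q) (hB : IsArc B q p) (hpq : p ≠ q)
    (hAB : A ∩ B ⊆ {p, q}) : ∃ P ∈ PX, A ∪ B ⊆ P := by
  obtain ⟨a, f, ha, hfc, hfi, hf0, hf1, rfl⟩ := hA
  obtain ⟨b, g, hb, hgc, hgi, hg0, hg1, rfl⟩ := hB
  have hfg : f a = g 0 := hf1.trans hg0.symm
  have ha' : 0 < a := lt_of_le_of_ne ha (by rintro rfl; exact hpq (hf0.symm.trans hf1))
  have hs : 0 < a + b := by linarith
  set F := concat f g a with hF
  have hF0 : F 0 = p := by rw [hF, concat_of_le ha, hf0]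
  have hF1 : F (a + b) = p := by
    rw [hF, concat_of_ge hfg (by linarith), add_sub_cancel_left, hg1]
  have hFinj : InjOn F (Ico 0 (a + b)) := by
    have key : ∀ u ∈ Icc 0 a, ∀ v ∈ Ico a (a + b), F u = F v → u = v := by
      intro u hu v hv huv
      rw [hF, concat_of_le hu.2, concat_of_ge hfg hv.1] at huv
      have hv' : v - a ∈ Icc 0 b := ⟨by linarith [hv.1], by linarith [hv.2]⟩
      rcases hAB ⟨⟨u, hu, rfl⟩, ⟨v - a, hv', huv.symm⟩⟩ with hq | hq
      · have h2 := hgi hv' ⟨hb, le_rfl⟩ ((huv.symm.trans hq).trans hg1.symm)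
        linarith [hv.2]
      · have h1 := hfi hu ⟨ha, le_rfl⟩ (hq.trans hf1.symm)
        have h2 := hgi hv' ⟨le_rfl, hb⟩ ((huv.symm.trans hq).trans hg0.symm)
        linarith
    intro u hu v hv huv
    rcases le_total u a with h1 | h1 <;> rcases le_total v a with h2 | h2
    · rw [hF, concat_of_le h1, concat_of_le h2] at huv
      exact hfi ⟨hu.1, h1⟩ ⟨hv.1, h2⟩ huv
    · exact key u ⟨hu.1, h1⟩ v ⟨h2, hv.2⟩ huv
    · exact (key v ⟨hv.1, h2⟩ u ⟨h1, hu.2⟩ huv.symm).symm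
    · rw [hF, concat_of_ge hfg h1, concat_of_ge hfg h2] at huv
      have := hgi ⟨sub_nonneg.2 h1, by linarith [hu.2]⟩ ⟨sub_nonneg.2 h2, by linarith [hv.2]⟩ huv
      linarith
  have hmaps : MapsTo (fun t : ℝ => (a + b) * t) (Icc 0 1) (Icc 0 (a + b)) :=
    fun t ht => ⟨mul_nonneg hs.le ht.1, by nlinarith [ht.2]⟩
  have : Fact ((0 : ℝ) < 1) := ⟨one_pos⟩
  set G : ℝ → X := fun t => F ((a + b) * t) with hG
  have hGapply : ∀ t ∈ Ico (0 : ℝ) 1, AddCircle.liftIco 1 0 G (t : AddCircle (1 : ℝ)) = G t :=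
    fun t ht => AddCircle.liftIco_coe_apply (by simpa using ht)
  have hsurj : ∀ z : AddCircle (1 : ℝ), ∃ t ∈ Ico (0 : ℝ) 1, (t : AddCircle (1 : ℝ)) = z := by
    intro z
    have : z ∈ QuotientAddGroup.mk '' Ico (0 : ℝ) (0 + 1) := by
      rw [AddCircle.coe_image_Ico_eq]; trivial
    simpa using this
  obtain ⟨P, hP, hsub⟩ := hT.t2 (AddCircle.liftIco 1 0 G)
    (AddCircle.liftIco_zero_continuous (by simp [hG, hF0, hF1])
      ((concat_continuousOn hfg hfc hgc ha hb).comp (by fun_prop) hmaps)) (by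
      intro y z hyz
      obtain ⟨s, hs', rfl⟩ := hsurj y
      obtain ⟨t, ht', rfl⟩ := hsurj z
      rw [hGapply s hs', hGapply t ht'] at hyz
      have := hFinj ⟨mul_nonneg hs.le hs'.1, by nlinarith [hs'.2]⟩
        ⟨mul_nonneg hs.le ht'.1, by nlinarith [ht'.2]⟩ hyz
      rw [mul_left_cancel₀ hs.ne' this])
  refine ⟨P, hP, ?_⟩
  rw [← concat_image hfg ha hb]
  have hmem : ∀ t ∈ Ico 0 (a + b), F t ∈ P := by
    intro t ht
    have ht' : t / (a + b) ∈ Ico (0 : ℝ) 1 := ⟨div_nonneg ht.1 hs.le, (div_lt_one hs).2 ht.2⟩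
    have : G (t / (a + b)) = F t := by simp only [hG]; rw [mul_div_cancel₀ _ hs.ne']
    rw [← this, ← hGapply _ ht']
    exact hsub ⟨_, rfl⟩
  rintro _ ⟨t, ht, rfl⟩
  rcases ht.2.eq_or_lt with rfl | h
  · change F (a + b) ∈ P
    rw [hF1, ← hF0]
    exact hmem 0 ⟨le_rfl, hs⟩
  · exact hmem t ⟨ht.1, h⟩

theorem IsArc.eq_of_inter_piece_subset {PX : Set (Set X)} (hT : IsTreeGraded X PX)
    {P : Set X} (hP : P ∈ PX) {A : Set X} {p q : X} (hA : IsArc A p q) (hp : p ∈ P) (hq : q ∈ P)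
    (hAP : A ∩ P ⊆ {p, q}) : p = q := by
  by_contra hpq
  obtain ⟨δ, hδ, h0, h1, hδP⟩ := hT.geodesicSub P hP q hq p hp
  have hB := hδ.isArc dist_nonneg
  rw [h0, h1] at hB
  have hBP : δ '' Icc 0 (dist q p) ⊆ P := by rintro _ ⟨t, ht, rfl⟩; exact hδP t ht
  obtain ⟨Q, hQ, hsub⟩ := hA.exists_piece_of_loop hT hB hpq
    fun z hz => hAP ⟨hz.1, hBP hz.2⟩
  have hpB : p ∈ δ '' Icc 0 (dist q p) := ⟨_, ⟨dist_nonneg, le_rfl⟩, h1⟩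
  have hqB : q ∈ δ '' Icc 0 (dist q p) := ⟨_, ⟨le_rfl, dist_nonneg⟩, h0⟩
  have hQP : Q = P := by
    by_contra hne
    exact hpq (hT.t1 Q hQ P hP hne ⟨hsub (Or.inr hpB), hp⟩ ⟨hsub (Or.inr hqB), hq⟩)
  subst hQP
  obtain ⟨L, f, hL, -, hi, hf0, hf1, rfl⟩ := hA
  have hL' : 0 < L := lt_of_le_of_ne hL (by rintro rfl; exact hpq (hf0.symm.trans hf1))
  have hm : L / 2 ∈ Icc 0 L := ⟨by linarith, by linarith⟩
  rcases hAP ⟨⟨L / 2, hm, rfl⟩, hsub (Or.inl ⟨L / 2, hm, rfl⟩)⟩ with h | h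
  · linarith [hi hm ⟨le_rfl, hL⟩ (h.trans hf0.symm)]
  · linarith [hi hm ⟨hL, le_rfl⟩ (h.trans hf1.symm)]

end Arcs

section Projection

variable {X : Type*} [MetricSpace X]

/-- `p` is a nearest point of `S` to `x`. -/
def IsNearest (S : Set X) (x p : X) : Prop :=
  p ∈ S ∧ dist x p = infDist x S

theorem IsNearest.dist_le {S : Set X} {x p q : X} (h : IsNearest S x p) (hq : q ∈ S) :
    dist x p ≤ dist x q :=
  h.2 ▸ infDist_le_dist_of_mem hq

theorem IsNearest.eq_self {S : Set X} {x p : X} (h : IsNearest S x p) (hx : x ∈ S) : p = x := by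
  have := h.dist_le hx
  rw [dist_self] at this
  exact (dist_le_zero.1 this).symm

theorem IsGeodesicSegment.dist_left {γ : ℝ → X} {L t : ℝ} (h : IsGeodesicSegment γ 0 L)
    (ht : t ∈ Icc 0 L) : dist (γ 0) (γ t) = t := by
  rw [h 0 ⟨le_rfl, ht.1.trans ht.2⟩ t ht, zero_sub, abs_neg, abs_of_nonneg ht.1]

theorem IsGeodesicSegment.dist_right {γ : ℝ → X} {L t : ℝ} (h : IsGeodesicSegment γ 0 L)
    (ht : t ∈ Icc 0 L) : dist (γ L) (γ t) = L - t := by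
  rw [h L ⟨ht.1.trans ht.2, le_rfl⟩ t ht, abs_of_nonneg (by linarith [ht.2])]

theorem IsGeodesicSegment.reverse {γ : ℝ → X} {L : ℝ} (h : IsGeodesicSegment γ 0 L) :
    IsGeodesicSegment (fun t => γ (L - t)) 0 L := by
  intro s hs t ht
  rw [h _ ⟨by linarith [hs.2], by linarith [hs.1]⟩ _ ⟨by linarith [ht.2], by linarith [ht.1]⟩,
    abs_sub_comm]
  congr 1
  ring

/-- The set of times at which a geodesic is in a closed set is compact. -/
theorem IsGeodesicSegment.isCompact_preimage {γ : ℝ → X} {a b : ℝ} (h : IsGeodesicSegment γ a b)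
    {S : Set X} (hS : IsClosed S) : IsCompact (Icc a b ∩ γ ⁻¹' S) :=
  isCompact_Icc.of_isClosed_subset (h.continuousOn.preimage_isClosed_of_isClosed isClosed_Icc hS)
    inter_subset_left

/-- A geodesic which ends in a piece passes through the projection of its origin. -/
theorem IsGeodesicSegment.apply_dist_nearest {PX : Set (Set X)} (hT : IsTreeGraded X PX)
    (hG : GeodesicSpace X) {P : Set X} (hP : P ∈ PX) {γ : ℝ → X} {L : ℝ} (hL : 0 ≤ L)
    (hγ : IsGeodesicSegment γ 0 L) (hend : γ L ∈ P) {p : X} (hp : IsNearest P (γ 0) p) :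
    γ (dist (γ 0) p) = p := by
  obtain ⟨s, ⟨hs, hsP⟩, hsmin⟩ :=
    (hγ.isCompact_preimage (hT.closed P hP)).exists_isLeast ⟨L, ⟨hL, le_rfl⟩, hend⟩
  obtain ⟨δ, hδ, h0, h1⟩ := hG (γ 0) p
  set D := dist (γ 0) p with hD
  have hD0 : 0 ≤ D := dist_nonneg
  have hm0 : 0 ≤ min s D := le_min hs.1 hD0
  have hγs : IsGeodesicSegment γ 0 (min s D) := hγ.mono le_rfl ((min_le_left _ _).trans hs.2)
  have hδs : IsGeodesicSegment δ 0 (min s D) := hδ.mono le_rfl (min_le_right _ _)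
  obtain ⟨t, ⟨ht, hteq⟩, htmax⟩ :
      ∃ t, IsGreatest {t | t ∈ Icc 0 (min s D) ∧ γ t = δ t} t := by
    refine IsCompact.exists_isGreatest ?_ ⟨0, ⟨le_rfl, hm0⟩, h0.symm⟩
    refine isCompact_Icc.of_isClosed_subset ?_ fun t ht => ht.1
    have := (hγs.continuousOn.prodMk hδs.continuousOn).preimage_isClosed_of_isClosed isClosed_Icc
      isClosed_diagonal
    exact this
  have hts : t ≤ s := ht.2.trans (min_le_left _ _)
  have htD : t ≤ D := ht.2.trans (min_le_right _ _)
  have hA := ((hγ.mono ht.1 hs.2).isArc hts).symm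
  have hB := (hδ.mono ht.1 le_rfl).isArc htD
  rw [← hteq, h1] at hB
  have key : γ s = p := by
    refine (hA.trans hB ?_).eq_of_inter_piece_subset hT hP hsP hp.1 ?_
    · rintro _ ⟨⟨a, ha, rfl⟩, ⟨b, hb, hab⟩⟩
      have e1 := hγ.dist_left ⟨ht.1.trans ha.1, ha.2.trans hs.2⟩
      have e2 := hδ.dist_left ⟨ht.1.trans hb.1, hb.2⟩
      rw [h0, hab, e1] at e2
      subst e2
      have := htmax ⟨⟨ht.1.trans ha.1, le_min ha.2 hb.2⟩, hab.symm⟩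
      rw [le_antisymm this ha.1]
      rfl
    · rintro _ ⟨⟨a, ha, rfl⟩ | ⟨b, hb, rfl⟩, hzP⟩
      · left
        rw [le_antisymm ha.2 (hsmin ⟨⟨ht.1.trans ha.1, ha.2.trans hs.2⟩, hzP⟩)]
      · right
        have e2 := hδ.dist_left ⟨ht.1.trans hb.1, hb.2⟩
        have := hp.dist_le hzP
        rw [← h0, e2, h0] at this
        rw [le_antisymm hb.2 this, h1]
        rfl
  rw [hD, ← key, hγ.dist_left hs]

theorem IsNearest.dist_eq {PX : Set (Set X)} (hT : IsTreeGraded X PX)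
    (hG : GeodesicSpace X) {P : Set X} (hP : P ∈ PX) {x p q : X} (hp : IsNearest P x p)
    (hq : q ∈ P) : dist x q = dist x p + dist p q := by
  obtain ⟨γ, hγ, rfl, h1⟩ := hG x q
  set L := dist (γ 0) q
  have h := hγ.apply_dist_nearest hT hG hP dist_nonneg (by rwa [h1]) hp
  have hle : dist (γ 0) p ∈ Icc 0 L := ⟨dist_nonneg, hp.dist_le hq⟩
  have := hγ.dist_right hle
  rw [h, h1, dist_comm] at this
  linarith

theorem IsNearest.eq_of_dist_eq {PX : Set (Set X)} (hT : IsTreeGraded X PX)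
    (hG : GeodesicSpace X) {P : Set X} (hP : P ∈ PX) {u p w p' : X} (hp : IsNearest P u p)
    (hw : IsNearest P w p') (h : dist u w + dist w p = dist u p) : p' = p := by
  have h1 := hp.dist_eq hT hG hP hw.1
  have h2 := hw.dist_le hp.1
  have h3 := dist_triangle u w p'
  exact (dist_le_zero.1 (by linarith)).symm

/-- A geodesic whose endpoints have different projections to a piece meets this piece. -/
theorem IsGeodesicSegment.exists_mem_piece {PX : Set (Set X)} (hT : IsTreeGraded X PX)
    (hG : GeodesicSpace X) {P : Set X} (hP : P ∈ PX) {π : X → X} (hπ : ∀ x, IsNearest P x (π x))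
    {γ : ℝ → X} {L : ℝ} (hL : 0 ≤ L)
    (hγ : IsGeodesicSegment γ 0 L) (hne : π (γ 0) ≠ π (γ L)) :
    ∃ t ∈ Icc 0 L, γ t ∈ P := by
  by_contra! hcon
  have hclosed : IsClosed (γ '' Icc 0 L) := (isCompact_Icc.image_of_continuousOn
    hγ.continuousOn).isClosed
  -- the part of a geodesic from `π u` to a point `u` of `γ` before it meets `γ`
  have leg : ∀ u ∈ γ '' Icc 0 L, ∃ (A : Set X) (s : ℝ), s ∈ Icc 0 L ∧ IsArc A (π u) (γ s) ∧
      A ∩ γ '' Icc 0 L ⊆ {γ s} ∧ ∀ w ∈ A, π w = π u := by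
    intro u hu
    obtain ⟨α, hα, h0, h1⟩ := hG (π u) u
    obtain ⟨a, ⟨ha, ⟨s, hs, hsa⟩⟩, hamin⟩ :=
      (hα.isCompact_preimage hclosed).exists_isLeast ⟨_, ⟨dist_nonneg, le_rfl⟩, by
        rwa [mem_preimage, h1]⟩
    have harc := (hα.mono le_rfl ha.2).isArc ha.1
    rw [h0, ← hsa] at harc
    refine ⟨_, s, hs, harc, ?_, ?_⟩
    · rintro _ ⟨⟨t, ht, rfl⟩, htγ⟩
      rw [hsa, le_antisymm ht.2 (hamin ⟨⟨ht.1, ht.2.trans ha.2⟩, htγ⟩)]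
      rfl
    · rintro _ ⟨t, ht, rfl⟩
      have ht' : t ∈ Icc 0 (dist (π u) u) := ⟨ht.1, ht.2.trans ha.2⟩
      refine (hπ u).eq_of_dist_eq hT hG hP (hπ _) ?_
      have e1 := hα.dist_left ht'
      have e2 := hα.dist_right ht'
      rw [h0] at e1
      rw [h1] at e2
      rw [e2, dist_comm _ (π u), e1, dist_comm u]
      ring
  obtain ⟨A, s, hs, hA, hAγ, hAπ⟩ := leg (γ 0) ⟨0, ⟨le_rfl, hL⟩, rfl⟩
  obtain ⟨B, s', hs', hB, hBγ, hBπ⟩ := leg (γ L) ⟨L, ⟨hL, le_rfl⟩, rfl⟩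
  have hsub : γ '' uIcc s s' ⊆ γ '' Icc 0 L := image_mono (uIcc_subset_Icc hs hs')
  have hAC := hA.trans (hγ.isArc_uIcc hs hs') fun w hw => hAγ ⟨hw.1, hsub hw.2⟩
  have hACB := hAC.trans hB.symm (by
    rintro w ⟨hw1 | hw1, hw2⟩
    · exact absurd ((hAπ w hw1).symm.trans (hBπ w hw2)) hne
    · exact hBγ ⟨hw2, hsub hw1⟩)
  refine hne (hACB.eq_of_inter_piece_subset hT hP (hπ _).1 (hπ _).1 ?_)
  rintro w ⟨(hw | hw) | hw, hwP⟩
  · exact Or.inl (((hπ w).eq_self hwP).symm.trans (hAπ w hw))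
  · obtain ⟨t, ht, rfl⟩ := hsub hw
    exact absurd hwP (hcon t ht)
  · exact Or.inr (((hπ w).eq_self hwP).symm.trans (hBπ w hw))

/-- If a geodesic meets a piece, then it does so between the projections of its endpoints. -/
theorem IsGeodesicSegment.mem_piece_iff {PX : Set (Set X)} (hT : IsTreeGraded X PX)
    (hG : GeodesicSpace X) {P : Set X} (hP : P ∈ PX) {π : X → X} (hπ : ∀ x, IsNearest P x (π x))
    {γ : ℝ → X} {L t₀ : ℝ} (hγ : IsGeodesicSegment γ 0 L) (ht₀ : t₀ ∈ Icc 0 L) (htP : γ t₀ ∈ P) :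
    ∃ s e, 0 ≤ s ∧ s ≤ e ∧ e ≤ L ∧ γ s = π (γ 0) ∧ γ e = π (γ L) ∧
      ∀ t ∈ Icc 0 L, γ t ∈ P ↔ t ∈ Icc s e := by
  have hs := (hγ.mono le_rfl ht₀.2).apply_dist_nearest hT hG hP ht₀.1 htP (hπ _)
  have he := (hγ.reverse.mono le_rfl (by linarith [ht₀.1] : L - t₀ ≤ L)).apply_dist_nearest hT hG hP
    (by linarith [ht₀.2]) (by simpa using htP) (hπ _)
  simp only [sub_zero] at he
  set s := dist (γ 0) (π (γ 0)) with hs_def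
  set d := dist (γ L) (π (γ L)) with hd_def
  have hst : ∀ t ∈ Icc 0 L, γ t ∈ P → t ∈ Icc s (L - d) := by
    intro t ht hmem
    have h1 := (hπ (γ 0)).dist_le hmem
    have h2 := (hπ (γ L)).dist_le hmem
    rw [hγ.dist_left ht] at h1
    rw [hγ.dist_right ht] at h2
    exact ⟨h1, by linarith⟩
  have hs0 : 0 ≤ s := dist_nonneg
  have hd0 : 0 ≤ d := dist_nonneg
  have hse := hst t₀ ht₀ htP
  refine ⟨s, L - d, hs0, hse.1.trans hse.2, by linarith, hs, he,
    fun t ht => ⟨hst t ht, fun hmem => ?_⟩⟩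
  have h1 := (hπ (γ t)).dist_eq hT hG hP (hπ (γ 0)).1
  have h2 := (hπ (γ t)).dist_eq hT hG hP (hπ (γ L)).1
  have hsm : s ∈ Icc 0 L := ⟨hs0, hse.1.trans ht₀.2⟩
  have hem : L - d ∈ Icc 0 L := ⟨ht₀.1.trans hse.2, by linarith⟩
  have h3 := hγ s hsm (L - d) hem
  rw [← hs, hγ t ht s hsm, abs_of_nonneg (by linarith [hmem.1])] at h1
  rw [← he, hγ t ht (L - d) hem, abs_of_nonpos (by linarith [hmem.2])] at h2
  rw [abs_of_nonpos (by linarith [hmem.1, hmem.2])] at h3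
  have h4 := dist_triangle_left (γ s) (γ (L - d)) (π (γ t))
  have h5 : dist (γ t) (π (γ t)) = 0 := le_antisymm (by linarith) dist_nonneg
  rw [dist_eq_zero.1 h5]
  exact (hπ _).1

theorem dist_eq_of_proj_ne {PX : Set (Set X)} (hT : IsTreeGraded X PX)
    (hG : GeodesicSpace X) {P : Set X} (hP : P ∈ PX) {π : X → X} (hπ : ∀ x, IsNearest P x (π x))
    {x y : X} (hne : π x ≠ π y) :
    dist x y = dist x (π x) + dist (π x) (π y) + dist (π y) y := by
  obtain ⟨γ, hγ, h0, h1⟩ := hG x y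
  obtain ⟨t, ht, htP⟩ := hγ.exists_mem_piece hT hG hP hπ dist_nonneg (by rwa [h0, h1])
  obtain ⟨s, e, hs0, hse, heL, hs, he, -⟩ := hγ.mem_piece_iff hT hG hP hπ ht htP
  have e1 := hγ.dist_left ⟨hs0, hse.trans heL⟩
  have e2 := hγ.dist_right ⟨hs0.trans hse, heL⟩
  have e3 := hγ s ⟨hs0, hse.trans heL⟩ e ⟨hs0.trans hse, heL⟩
  rw [abs_of_nonpos (by linarith)] at e3
  rw [hs, he, h0, h1] at e3
  rw [hs, h0] at e1
  rw [he, h1, dist_comm] at e2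
  linarith

theorem dist_proj_le {PX : Set (Set X)} (hT : IsTreeGraded X PX)
    (hG : GeodesicSpace X) {P : Set X} (hP : P ∈ PX) {π : X → X} (hπ : ∀ x, IsNearest P x (π x))
    (x y : X) : dist (π x) (π y) ≤ dist x y := by
  by_cases hne : π x = π y
  · simp [hne]
  · rw [dist_eq_of_proj_ne hT hG hP hπ hne]
    linarith [dist_nonneg (x := x) (y := π x), dist_nonneg (x := π y) (y := y)]

end Projection

section Intervals

/-- The pairs `(u, v)` such that `[u, v]` is a connected component of `S`, isolated from the
rest of `S`. -/
def isolatedIntervals (S : Set ℝ) : Set (ℝ × ℝ) :=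
  {p | p.1 ≤ p.2 ∧ Icc p.1 p.2 ⊆ S ∧ ∃ ε > 0, S ∩ Ioo (p.1 - ε) (p.2 + ε) ⊆ Icc p.1 p.2}

theorem isolatedIntervals_iUnion_Icc {ι : Type*} [Finite ι] {a b : ι → ℝ} (hab : ∀ i, a i ≤ b i)
    (hsep : ∀ i j, i ≠ j → b i < a j ∨ b j < a i) :
    isolatedIntervals (⋃ i, Icc (a i) (b i)) = range fun i => (a i, b i) := by
  have hgap : ∀ i, ∃ ε > 0, (⋃ i, Icc (a i) (b i)) ∩ Ioo (a i - ε) (b i + ε) ⊆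
      Icc (a i) (b i) := by
    intro i
    have hev : ∀ j, ∀ᶠ ε : ℝ in nhdsWithin 0 (Ioi 0), j ≠ i → b i + ε < a j ∨ b j < a i - ε := by
      intro j
      by_cases hji : j = i
      · simp [hji]
      rcases hsep i j (Ne.symm hji) with h | h
      · filter_upwards [Ioo_mem_nhdsGT (sub_pos.2 h)] with ε hε _
        exact Or.inl (by linarith [hε.2])
      · filter_upwards [Ioo_mem_nhdsGT (sub_pos.2 h)] with ε hε _
        exact Or.inr (by linarith [hε.2])
    obtain ⟨ε, hε, hpos⟩ := ((Filter.eventually_all.2 hev).and self_mem_nhdsWithin).exists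
    refine ⟨ε, hpos, ?_⟩
    rintro t ⟨ht, ht'⟩
    obtain ⟨j, hj⟩ := mem_iUnion.1 ht
    by_cases hji : j = i
    · rwa [hji] at hj
    · rcases hε j hji with h | h
      · linarith [ht'.2, hj.1]
      · linarith [ht'.1, hj.2]
  ext ⟨u, v⟩
  constructor
  · rintro ⟨huv, hsub, ε, hε, hiso⟩
    simp only at huv hsub hiso
    obtain ⟨i, hi⟩ := mem_iUnion.1 (hsub ⟨le_rfl, huv⟩)
    obtain ⟨η, hη, hisoi⟩ := hgap i
    refine ⟨i, ?_⟩
    have hau : a i = u := by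
      by_contra hne
      have hlt := lt_of_le_of_ne hi.1 hne
      obtain ⟨t, ht1, ht2⟩ := exists_between (max_lt hlt (sub_lt_self u hε))
      have := hiso ⟨mem_iUnion.2 ⟨i, (le_max_left _ _).trans ht1.le, ht2.le.trans hi.2⟩,
        (le_max_right _ _).trans_lt ht1, by linarith⟩
      linarith [this.1]
    have hbv : b i = v := by
      rcases lt_trichotomy (b i) v with hlt | heq | hlt
      · obtain ⟨t, ht1, ht2⟩ := exists_between (lt_min hlt (lt_add_of_pos_right (b i) hη))
        have := hisoi ⟨hsub ⟨hi.2.trans ht1.le, ht2.le.trans (min_le_left _ _)⟩,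
          by linarith [hab i], ht2.trans_le (min_le_right _ _)⟩
        linarith [this.2]
      · exact heq
      · obtain ⟨t, ht1, ht2⟩ := exists_between (lt_min hlt (lt_add_of_pos_right v hε))
        have := hiso ⟨mem_iUnion.2 ⟨i, by linarith, ht2.le.trans (min_le_left _ _)⟩,
          by linarith, ht2.trans_le (min_le_right _ _)⟩
        linarith [this.2]
    exact Prod.ext hau hbv
  · rintro ⟨i, hi⟩
    obtain ⟨rfl, rfl⟩ := Prod.mk.inj hi
    exact ⟨hab i, subset_iUnion (fun i => Icc (a i) (b i)) i, hgap i⟩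

theorem isolatedIntervals_union_Icc {S : Set ℝ} {M c d : ℝ} (hS : S ⊆ Iic M) (hMc : M < c) :
    {p ∈ isolatedIntervals (S ∪ Icc c d) | p.1 ≤ M} = isolatedIntervals S := by
  ext ⟨u, v⟩
  constructor
  · rintro ⟨⟨huv, hsub, ε, hε, hiso⟩, huM⟩
    simp only at huv hsub hiso huM
    have hvM : v ≤ M := by
      by_contra! hlt
      obtain ⟨t, ht1, ht2⟩ := exists_between (lt_min hlt hMc)
      rcases hsub ⟨huM.trans ht1.le, ht2.le.trans (min_le_left _ _)⟩ with h | h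
      · exact absurd (hS h) (not_le.2 ht1)
      · exact absurd (h.1.trans_lt (ht2.trans_le (min_le_right _ _))) (lt_irrefl _)
    refine ⟨huv, fun t ht => ?_, ε, hε, fun t ht => hiso ⟨Or.inl ht.1, ht.2⟩⟩
    rcases hsub ht with h | h
    · exact h
    · linarith [h.1, ht.2]
  · rintro ⟨huv, hsub, ε, hε, hiso⟩
    simp only at huv hsub hiso
    have hvM : v ≤ M := hS (hsub ⟨huv, le_rfl⟩)
    refine ⟨⟨huv, fun t ht => Or.inl (hsub ht), min ε (c - M), lt_min hε (sub_pos.2 hMc), ?_⟩,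
      huv.trans hvM⟩
    rintro t ⟨ht | ht, ht'⟩
    · exact hiso ⟨ht, by linarith [ht'.1, min_le_left ε (c - M)],
        by linarith [ht'.2, min_le_left ε (c - M)]⟩
    · linarith [ht.1, ht'.2, min_le_right ε (c - M)]

/-- A sum over the components of `S ∪ [c, d]`, where the component `[c, d]` does not contribute,
only depends on `S`. -/
theorem sum_components_union_Icc {ι : Type*} [Fintype ι] {a b : ι → ℝ} (hab : ∀ i, a i ≤ b i)
    (hsep : ∀ i j, i ≠ j → b i < a j ∨ b j < a i) {S : Set ℝ} {M c d : ℝ} (hS : S ⊆ Iic M)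
    (hMc : M < c) (hunion : S ∪ Icc c d = ⋃ i, Icc (a i) (b i)) (g h : ℝ → ℝ → ℕ)
    (hg : ∀ u v, c ≤ u → u ≤ v → v ≤ d → g u v = 0)
    (hgh : ∀ u v, u ≤ v → Icc u v ⊆ S → g u v = h u v) :
    ∑ i, g (a i) (b i) = ∑ᶠ p ∈ isolatedIntervals S, h p.1 p.2 := by
  classical
  have hrange := isolatedIntervals_iUnion_Icc hab hsep
  rw [← hunion] at hrange
  have hinj : Function.Injective fun i => (a i, b i) := by
    intro i j hij
    by_contra hne
    obtain ⟨h1, h2⟩ := Prod.mk.inj hij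
    rcases hsep i j hne with h | h <;> linarith [hab i, hab j]
  have hset : isolatedIntervals S =
      (((Finset.univ.filter fun i => a i ≤ M).image fun i => (a i, b i) : Finset (ℝ × ℝ)) :
        Set (ℝ × ℝ)) := by
    rw [← isolatedIntervals_union_Icc hS hMc (d := d), hrange]
    ext ⟨u, v⟩
    simp only [mem_ofPred_eq, mem_range, Finset.coe_image, Finset.coe_filter, Finset.mem_univ,
      true_and, mem_image]
    constructor
    · rintro ⟨⟨i, hi⟩, hu⟩
      exact ⟨i, by rwa [(Prod.mk.inj hi).1], hi⟩
    · rintro ⟨i, hi, hi'⟩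
      exact ⟨⟨i, hi'⟩, by rwa [← (Prod.mk.inj hi').1]⟩
  have hmem : ∀ i, a i ≤ M → Icc (a i) (b i) ⊆ S := by
    intro i hi
    have : (a i, b i) ∈ isolatedIntervals S := by
      rw [← isolatedIntervals_union_Icc hS hMc (d := d), hrange]
      exact ⟨⟨i, rfl⟩, hi⟩
    exact this.2.1
  rw [finsum_mem_congr (t := _) hset fun _ _ => rfl, finsum_mem_coe_finset,
    Finset.sum_image hinj.injOn, Finset.sum_filter]
  refine Finset.sum_congr rfl fun i _ => ?_
  split_ifs with hi
  · exact hgh _ _ (hab i) (hmem i hi)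
  · have h1 : Icc (a i) (b i) ⊆ S ∪ Icc c d := by
      rw [hunion]; exact subset_iUnion (fun i => Icc (a i) (b i)) i
    have key : ∀ t ∈ Icc (a i) (b i), t ∈ Icc c d := fun t ht =>
      (h1 ht).resolve_left fun hm => hi (ht.1.trans (hS hm))
    exact hg _ _ (key _ ⟨le_rfl, hab i⟩).1 (hab i) (key _ ⟨hab i, le_rfl⟩).2

end Intervals

section Coloring

variable {X : Type*} [MetricSpace X] {PX : Set (Set X)} {n : ℕ} {r fr : ℝ} {xhat : X}
  {proj : Set X → X → X} {cP : Set X → X → Fin (n + 1)}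

theorem ColoringSetup.isNearest (hS : ColoringSetup X PX n r fr xhat proj cP) {P : Set X}
    (hP : P ∈ PX) (x : X) : IsNearest P x (proj P x) :=
  ⟨hS.projMem P hP x, hS.projDist P hP x⟩

theorem ColoringSetup.mem_pieceComp (hS : ColoringSetup X PX n r fr xhat proj cP) {P : Set X}
    (hP : P ∈ PX) {y : X} (hy : y ∈ P) (hd : dist y (proj P xhat) < r) :
    y ∈ pieceComp r xhat proj cP P := by
  have hr := hS.rpos
  have hbase := hS.projMem P hP xhat
  refine ⟨1, fun i => if i = 0 then proj P xhat else y, by simp, by simp, fun i _ => ?_,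
    fun i hi => ?_⟩
  · by_cases h : i = 0
    · simpa [h] using ⟨hbase, hS.ballZero P hP _ hbase (by simpa using hr.le)⟩
    · simpa [h] using ⟨hy, hS.ballZero P hP _ hy (by linarith)⟩
  · simpa [Nat.lt_one_iff.1 hi, dist_comm] using hd

theorem floorLen_le {γ : ℝ → X} (hT : IsTreeGraded X PX) {a b : ℝ} (hab : a ≤ b) :
    floorLen PX γ a b ≤ b - a := by
  obtain ⟨P, hP, hmem⟩ := hT.covers (γ b)
  have : sInf {t | t ∈ Icc a b ∧ ∃ P ∈ PX, γ '' Icc t b ⊆ P} ≤ b :=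
    csInf_le ⟨a, fun t ht => ht.1.1⟩ ⟨⟨hab, le_rfl⟩, P, hP, by simpa using hmem⟩
  exact sub_le_sub_right this a

/-- `γ : [0, L] → X` is a geodesic from `xhat` which follows `σ` up to the base point `σ ℓ` of the
long piece `P`, leaves `P` at time `c`, and ends less than `r` later. -/
structure IsBranch (PX : Set (Set X)) (r : ℝ) (xhat : X) (proj : Set X → X → X)
    (cP : Set X → X → Fin (n + 1)) (P : Set X) (σ : ℝ → X) (ℓ : ℝ) (γ : ℝ → X) (c L : ℝ) :
    Prop where
  piece : P ∈ PX
  geodesic : IsGeodesicSegment γ 0 L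
  start : γ 0 = xhat
  nonneg : 0 ≤ ℓ
  eqOn : ∀ t ∈ Icc 0 ℓ, γ t = σ t
  base : σ ℓ = proj P xhat
  exit : γ c = proj P (γ L)
  add_le : ℓ + r ≤ c
  le_length : c ≤ L
  length_lt : L < c + r
  mem_iff : ∀ t ∈ Icc 0 L, γ t ∈ P ↔ t ∈ Icc ℓ c
  notMem : proj P (γ L) ∉ pieceComp r xhat proj cP P

theorem ColoringSetup.exists_isBranch (hS : ColoringSetup X PX n r fr xhat proj cP) {P : Set X}
    (hP : P ∈ PX) {σ : ℝ → X} (hσ : IsGeodesicSegment σ 0 (dist xhat (proj P xhat)))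
    (hσ0 : σ 0 = xhat) (hσ1 : σ (dist xhat (proj P xhat)) = proj P xhat) {z : X}
    (hz : proj P z ∉ pieceComp r xhat proj cP P) (hd : dist z (proj P z) < r) :
    ∃ γ c L, γ L = z ∧
      IsBranch PX r xhat proj cP P σ (dist xhat (proj P xhat)) γ c L := by
  have hT := hS.treeGraded
  have hG := hS.geodesic
  have hr := hS.rpos
  have hN := hS.isNearest hP
  have hfar : r ≤ dist (proj P z) (proj P xhat) :=
    not_lt.1 fun h => hz (hS.mem_pieceComp hP (hN z).1 h)
  have hne : proj P xhat ≠ proj P z := by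
    intro h
    rw [h, dist_self] at hfar
    linarith
  have h1 := dist_eq_of_proj_ne hT hG hP hN hne
  have h2 := (hN z).dist_eq hT hG hP (hN xhat).1
  obtain ⟨τ, hτ, hτ0, hτ1⟩ := hG (proj P xhat) z
  set ℓ := dist xhat (proj P xhat)
  have hℓ : 0 ≤ ℓ := dist_nonneg
  have hm : 0 ≤ dist (proj P xhat) z := dist_nonneg
  have hfg : σ ℓ = τ 0 := hσ1.trans hτ0.symm
  have hγ := hσ.concat hτ hfg hℓ hm (by
    rw [hσ0, hτ1, h1, dist_comm _ z, dist_comm (proj P xhat) z, h2,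
      dist_comm (proj P xhat) (proj P z)]
    ring)
  set γ := concat σ τ ℓ
  set L := ℓ + dist (proj P xhat) z with hL
  have hγ0 : γ 0 = xhat := (concat_of_le hℓ).trans hσ0
  have hγL : γ L = z := by
    rw [← hτ1]
    exact (concat_of_ge hfg (by linarith)).trans (by rw [hL, add_sub_cancel_left])
  have hγℓ : γ ℓ = proj P xhat := (concat_of_le le_rfl).trans hσ1
  obtain ⟨s, e, hs0, hse, heL, hs, he, hmem⟩ := hγ.mem_piece_iff hT hG hP hN
    (t₀ := ℓ) ⟨hℓ, by linarith⟩ (hγℓ ▸ (hN xhat).1)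
  have hsl : s = ℓ := hγ.injOn ⟨hs0, by linarith⟩ ⟨hℓ, by linarith⟩
    (hs.trans (by rw [hγ0, hγℓ]))
  rw [hsl] at hse hmem
  have e1 := hγ ℓ ⟨hℓ, by linarith⟩ e ⟨by linarith, heL⟩
  rw [hγℓ, he, hγL, abs_of_nonpos (by linarith), dist_comm] at e1
  have e2 := hγ.dist_right (t := e) ⟨by linarith, heL⟩
  rw [he, hγL] at e2
  exact ⟨γ, e, L, hγL, hP, hγ, hγ0, hℓ, fun t ht => concat_of_le ht.2, hσ1, he, by linarith, heL,
    by linarith, hmem, hγL.symm ▸ hz⟩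

namespace IsBranch

variable {P Q : Set X} {σ γ : ℝ → X} {ℓ c L : ℝ}

theorem length_nonneg (h : IsBranch PX r xhat proj cP P σ ℓ γ c L)
    (hS : ColoringSetup X PX n r fr xhat proj cP) : ℓ < c ∧ ℓ ≤ L := by
  have := hS.rpos
  have := h.add_le
  have := h.le_length
  constructor <;> linarith

theorem geodesic_base (h : IsBranch PX r xhat proj cP P σ ℓ γ c L)
    (hS : ColoringSetup X PX n r fr xhat proj cP) : IsGeodesicSegment σ 0 ℓ := by
  intro s hs t ht
  have hℓL := (h.length_nonneg hS).2
  rw [← h.eqOn s hs, ← h.eqOn t ht]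
  exact h.geodesic s ⟨hs.1, hs.2.trans hℓL⟩ t ⟨ht.1, ht.2.trans hℓL⟩

theorem start_base (h : IsBranch PX r xhat proj cP P σ ℓ γ c L) : σ 0 = xhat := by
  rw [← h.eqOn 0 ⟨le_rfl, h.nonneg⟩, h.start]

/-- A branch leaves every piece `Q ≠ P` before entering `P`, or stays in it for a short time. -/
theorem exists_interval (h : IsBranch PX r xhat proj cP P σ ℓ γ c L)
    (hS : ColoringSetup X PX n r fr xhat proj cP) (hQ : Q ∈ PX) (hQP : Q ≠ P) {t₀ : ℝ}
    (ht₀ : t₀ ∈ Icc 0 L) (htQ : γ t₀ ∈ Q) :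
    ∃ s e, 0 ≤ s ∧ s ≤ e ∧ e ≤ L ∧ γ s = proj Q xhat ∧ γ e = proj Q (γ L) ∧
      (∀ t ∈ Icc 0 L, γ t ∈ Q ↔ t ∈ Icc s e) ∧ (e ≤ ℓ ∨ ℓ < s ∧ e - s < r) := by
  obtain ⟨s, e, hs0, hse, heL, hs, he, hmem⟩ := h.geodesic.mem_piece_iff hS.treeGraded hS.geodesic
    hQ (hS.isNearest hQ) ht₀ htQ
  rw [h.start] at hs
  refine ⟨s, e, hs0, hse, heL, hs, he, hmem, ?_⟩
  by_contra! hcon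
  obtain ⟨hℓe, hcon⟩ := hcon
  obtain ⟨hℓc, hℓL⟩ := h.length_nonneg hS
  have hr := hS.rpos
  have hℓ := h.nonneg
  have hcL := h.le_length
  have hLc := h.length_lt
  have huniq : ∀ t ∈ Icc ℓ c ∩ Icc s e, ∀ t' ∈ Icc ℓ c ∩ Icc s e, t = t' := by
    have hP : ∀ t ∈ Icc ℓ c ∩ Icc s e, t ∈ Icc 0 L ∧ γ t ∈ Q ∩ P := by
      intro t ht
      have htL : t ∈ Icc 0 L := ⟨hℓ.trans ht.1.1, ht.1.2.trans hcL⟩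
      exact ⟨htL, (hmem t htL).2 ht.2, (h.mem_iff t htL).2 ht.1⟩
    intro t ht t' ht'
    exact h.geodesic.injOn (hP t ht).1 (hP t' ht').1
      (hS.treeGraded.t1 Q hQ P h.piece hQP (hP t ht).2 (hP t' ht').2)
  rcases le_or_gt c s with hcs | hsc
  · linarith [hcon (hℓc.trans_le hcs)]
  · have := huniq (max s ℓ) ⟨⟨le_max_right _ _, max_le hsc.le hℓc.le⟩,
        le_max_left _ _, max_le hse hℓe.le⟩ (min e c)
        ⟨⟨le_min hℓe.le hℓc.le, min_le_right _ _⟩, le_min hse hsc.le, min_le_left _ _⟩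
    rcases le_or_gt s ℓ with hsℓ | hsℓ
    · rw [max_eq_right hsℓ] at this
      exact absurd this (lt_min hℓe hℓc).ne
    · rw [max_eq_left hsℓ.le] at this
      have he' : e ≤ s := by
        by_contra! hlt
        exact absurd this (lt_min hlt hsc).ne
      linarith [hcon hsℓ]

theorem eq_of_meets (h : IsBranch PX r xhat proj cP P σ ℓ γ c L)
    (hS : ColoringSetup X PX n r fr xhat proj cP) (hQ : Q ∈ PX) (hQP : Q ≠ P)
    (hmeet : ∃ t ∈ Icc 0 ℓ, σ t ∈ Q) :
    proj Q (γ L) = proj Q (σ ℓ) ∧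
      {t | t ∈ Icc 0 L ∧ γ t ∈ Q} = {t | t ∈ Icc 0 ℓ ∧ σ t ∈ Q} := by
  obtain ⟨t₀, ht₀, htQ⟩ := hmeet
  have hℓL := (h.length_nonneg hS).2
  have ht₀L : t₀ ∈ Icc 0 L := ⟨ht₀.1, ht₀.2.trans hℓL⟩
  have htQ' : γ t₀ ∈ Q := by rwa [h.eqOn t₀ ht₀]
  obtain ⟨s, e, hs0, hse, heL, hs, he, hmem, hcase⟩ := h.exists_interval hS hQ hQP ht₀L htQ'
  have heℓ : e ≤ ℓ := hcase.resolve_right fun hc => by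
    linarith [((hmem t₀ ht₀L).1 htQ').1, hc.1, ht₀.2]
  obtain ⟨s', e', hs0', hse', heL', hs', he', hmem'⟩ :=
    (h.geodesic_base hS).mem_piece_iff hS.treeGraded hS.geodesic hQ (hS.isNearest hQ) ht₀ htQ
  have h1 : e ∈ Icc s' e' := by
    have : e ∈ Icc 0 ℓ := ⟨hs0.trans hse, heℓ⟩
    rw [← hmem' e this, ← h.eqOn e this, he]
    exact hS.projMem Q hQ _
  have h2 : e' ∈ Icc s e := by
    have : e' ∈ Icc 0 ℓ := ⟨hs0'.trans hse', heL'⟩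
    rw [← hmem e' ⟨this.1, heL'.trans hℓL⟩, h.eqOn e' this, he']
    exact hS.projMem Q hQ _
  have hee : e = e' := le_antisymm h1.2 h2.2
  refine ⟨?_, ?_⟩
  · rw [← he, ← he', ← hee, h.eqOn e ⟨hs0.trans hse, heℓ⟩]
  · ext t
    constructor
    · rintro ⟨ht, hmt⟩
      have ht' : t ∈ Icc 0 ℓ := ⟨ht.1, ((hmem t ht).1 hmt).2.trans heℓ⟩
      exact ⟨ht', by rwa [← h.eqOn t ht']⟩
    · rintro ⟨ht, hmt⟩
      exact ⟨⟨ht.1, ht.2.trans hℓL⟩, by rwa [h.eqOn t ht]⟩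

theorem meets_of_le_dist (h : IsBranch PX r xhat proj cP P σ ℓ γ c L)
    (hS : ColoringSetup X PX n r fr xhat proj cP) (hQ : Q ∈ PX) (hQP : Q ≠ P)
    (hd : r ≤ dist (proj Q (γ L)) (proj Q xhat)) : ∃ t ∈ Icc 0 ℓ, σ t ∈ Q := by
  have hr := hS.rpos
  have hℓL := (h.length_nonneg hS).2
  obtain ⟨t₀, ht₀, htQ⟩ := h.geodesic.exists_mem_piece hS.treeGraded hS.geodesic hQ
    (hS.isNearest hQ) (h.nonneg.trans hℓL) (by
      intro heq
      rw [h.start] at heq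
      rw [heq, dist_self] at hd
      linarith)
  obtain ⟨s, e, hs0, hse, heL, hs, he, hmem, hcase⟩ := h.exists_interval hS hQ hQP ht₀ htQ
  rw [← hs, ← he, h.geodesic e ⟨hs0.trans hse, heL⟩ s ⟨hs0, hse.trans heL⟩,
    abs_of_nonneg (by linarith)] at hd
  have heℓ : e ≤ ℓ := hcase.resolve_right fun hc => by linarith [hc.2]
  have hee : e ∈ Icc 0 ℓ := ⟨hs0.trans hse, heℓ⟩
  exact ⟨e, hee, by rw [← h.eqOn e hee, he]; exact hS.projMem Q hQ _⟩

theorem meets_of_le_dist_base (h : IsBranch PX r xhat proj cP P σ ℓ γ c L)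
    (hS : ColoringSetup X PX n r fr xhat proj cP) (hQ : Q ∈ PX)
    (hd : r ≤ dist (proj Q (σ ℓ)) (proj Q xhat)) : ∃ t ∈ Icc 0 ℓ, σ t ∈ Q := by
  have hr := hS.rpos
  refine (h.geodesic_base hS).exists_mem_piece hS.treeGraded hS.geodesic hQ
    (hS.isNearest hQ) h.nonneg fun heq => ?_
  rw [h.start_base] at heq
  rw [heq, dist_self] at hd
  linarith

theorem color_eq (h : IsBranch PX r xhat proj cP P σ ℓ γ c L)
    (hS : ColoringSetup X PX n r fr xhat proj cP) (hQ : Q ∈ PX) (hQP : Q ≠ P) :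
    cP Q (proj Q (γ L)) = cP Q (proj Q (σ ℓ)) := by
  have hr := hS.rpos
  by_cases hmeet : ∃ t ∈ Icc 0 ℓ, σ t ∈ Q
  · rw [(h.eq_of_meets hS hQ hQP hmeet).1]
  · have h1 := not_le.1 fun hd => hmeet (h.meets_of_le_dist hS hQ hQP hd)
    have h2 := not_le.1 fun hd => hmeet (h.meets_of_le_dist_base hS hQ hd)
    rw [hS.ballZero Q hQ _ (hS.projMem Q hQ _) (by linarith),
      hS.ballZero Q hQ _ (hS.projMem Q hQ _) (by linarith)]

theorem ne_of_isLongPiece_base (h : IsBranch PX r xhat proj cP P σ ℓ γ c L)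
    (hS : ColoringSetup X PX n r fr xhat proj cP)
    (hQ : IsLongPiece PX r xhat proj cP σ ℓ Q) : Q ≠ P := by
  rintro rfl
  have hbase := hS.projMem Q h.piece xhat
  refine hQ.2.2 (hS.mem_pieceComp h.piece (hS.projMem Q h.piece _) ?_)
  rw [h.base, (hS.isNearest h.piece _).eq_self hbase, dist_self]
  exact hS.rpos

theorem isLongPiece_iff (h : IsBranch PX r xhat proj cP P σ ℓ γ c L)
    (hS : ColoringSetup X PX n r fr xhat proj cP) :
    IsLongPiece PX r xhat proj cP γ L Q ↔ Q = P ∨ IsLongPiece PX r xhat proj cP σ ℓ Q := by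
  obtain ⟨hℓc, hℓL⟩ := h.length_nonneg hS
  constructor
  · rintro ⟨hQ, -, hlong⟩
    by_cases hQP : Q = P
    · exact Or.inl hQP
    · have hmeet := h.meets_of_le_dist hS hQ hQP
        (not_lt.1 fun hd => hlong (hS.mem_pieceComp hQ (hS.projMem Q hQ _) hd))
      refine Or.inr ⟨hQ, hmeet, ?_⟩
      rwa [← (h.eq_of_meets hS hQ hQP hmeet).1]
  · rintro (rfl | hQ)
    · exact ⟨h.piece, ⟨ℓ, ⟨h.nonneg, hℓL⟩, (h.mem_iff ℓ ⟨h.nonneg, hℓL⟩).2 ⟨le_rfl, hℓc.le⟩⟩,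
        h.notMem⟩
    · have ⟨hQX, ⟨t, ht, htQ⟩, hlong⟩ := hQ
      refine ⟨hQX, ⟨t, ⟨ht.1, ht.2.trans hℓL⟩, by rwa [h.eqOn t ht]⟩, ?_⟩
      rwa [(h.eq_of_meets hS hQX (h.ne_of_isLongPiece_base hS hQ) ⟨t, ht, htQ⟩).1]

theorem setOf_mem_eq (h : IsBranch PX r xhat proj cP P σ ℓ γ c L) :
    {t | t ∈ Icc 0 L ∧ γ t ∈ P} = Icc ℓ c := by
  ext t
  constructor
  · rintro ⟨ht, hmt⟩
    exact (h.mem_iff t ht).1 hmt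
  · intro ht
    have ht' : t ∈ Icc 0 L := ⟨h.nonneg.trans ht.1, ht.2.trans h.le_length⟩
    exact ⟨ht', (h.mem_iff t ht').2 ht⟩

theorem betaSet_eq (h : IsBranch PX r xhat proj cP P σ ℓ γ c L)
    (hS : ColoringSetup X PX n r fr xhat proj cP) :
    betaSet PX r xhat proj cP γ L =
      (betaSet PX r xhat proj cP σ ℓ ∪ Icc ℓ (ℓ + r / 2)) ∪ Icc c L := by
  have hr := hS.rpos
  have hℓ := h.nonneg
  have hadd := h.add_le
  have hcL := h.le_length
  obtain ⟨hℓc, hℓL⟩ := h.length_nonneg hS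
  have hmem : ∀ (δ : ℝ → X) (M t : ℝ), t ∈ betaSet PX r xhat proj cP δ M ↔ t ∈ Icc 0 M ∧
      ∀ Q, IsLongPiece PX r xhat proj cP δ M Q →
        t ∉ Ioo (pieceStart δ M Q + r / 2) (pieceEnd δ M Q) := by
    intro δ M t
    simp only [betaSet, mem_sdiff, mem_iUnion, mem_ofPred_eq, not_exists, exists_prop, not_and]
  have hPs : pieceStart γ L P = ℓ := by
    rw [pieceStart, h.setOf_mem_eq, csInf_Icc hℓc.le]
  have hPe : pieceEnd γ L P = c := by
    rw [pieceEnd, h.setOf_mem_eq, csSup_Icc hℓc.le]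
  have hQs : ∀ Q, IsLongPiece PX r xhat proj cP σ ℓ Q →
      pieceStart γ L Q = pieceStart σ ℓ Q ∧ pieceEnd γ L Q = pieceEnd σ ℓ Q := by
    intro Q hQ
    have := (h.eq_of_meets hS hQ.1 (h.ne_of_isLongPiece_base hS hQ) hQ.2.1).2
    simp only [pieceStart, pieceEnd, this, and_self]
  have hQe : ∀ Q, IsLongPiece PX r xhat proj cP σ ℓ Q → pieceEnd σ ℓ Q ≤ ℓ := by
    rintro Q ⟨-, ⟨t, ht⟩, -⟩
    exact csSup_le ⟨t, ht⟩ fun u hu => hu.1.2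
  ext t
  rw [mem_union, mem_union, hmem, hmem]
  constructor
  · rintro ⟨ht, hnot⟩
    have hP := hnot P ((h.isLongPiece_iff hS).2 (Or.inl rfl))
    rw [hPs, hPe] at hP
    rcases le_or_gt c t with hct | hct
    · exact Or.inr ⟨hct, ht.2⟩
    rcases le_or_gt ℓ t with hlt | hlt
    · exact Or.inl (Or.inr ⟨hlt, not_lt.1 fun hlt' => hP ⟨hlt', hct⟩⟩)
    · refine Or.inl (Or.inl ⟨⟨ht.1, hlt.le⟩, fun Q hQ => ?_⟩)
      rw [← (hQs Q hQ).1, ← (hQs Q hQ).2]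
      exact hnot Q ((h.isLongPiece_iff hS).2 (Or.inr hQ))
  · intro ht
    have htL : t ∈ Icc 0 L := by
      rcases ht with (ht | ht) | ht
      · exact ⟨ht.1.1, ht.1.2.trans hℓL⟩
      · exact ⟨hℓ.trans ht.1, by linarith [ht.2]⟩
      · exact ⟨by linarith [ht.1], ht.2⟩
    refine ⟨htL, fun Q hQ => ?_⟩
    rcases (h.isLongPiece_iff hS).1 hQ with rfl | hQ'
    · rw [hPs, hPe]
      intro hm
      rcases ht with (ht | ht) | ht
      · linarith [ht.1.2, hm.1]
      · linarith [ht.2, hm.1]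
      · linarith [ht.1, hm.2]
    · rw [(hQs Q hQ').1, (hQs Q hQ').2]
      intro hm
      have := hQe Q hQ'
      rcases ht with (ht | ht) | ht
      · exact ht.2 Q hQ' hm
      · linarith [ht.1, hm.2]
      · linarith [ht.1, hm.2]

theorem floorLen_of_le (h : IsBranch PX r xhat proj cP P σ ℓ γ c L) {a b : ℝ}
    (ha : 0 ≤ a) (hb : b ≤ ℓ) : floorLen PX γ a b = floorLen PX σ a b := by
  have himage : ∀ t ∈ Icc a b, γ '' Icc t b = σ '' Icc t b := fun t ht =>
    image_congr fun u hu => h.eqOn u ⟨ha.trans (ht.1.trans hu.1), hu.2.trans hb⟩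
  have hset : {t | t ∈ Icc a b ∧ ∃ P ∈ PX, γ '' Icc t b ⊆ P} =
      {t | t ∈ Icc a b ∧ ∃ P ∈ PX, σ '' Icc t b ⊆ P} := by
    ext t
    exact and_congr_right fun ht => by rw [himage t ht]
  rw [floorLen, floorLen, hset]

theorem floorLen_of_gt (h : IsBranch PX r xhat proj cP P σ ℓ γ c L)
    (hS : ColoringSetup X PX n r fr xhat proj cP) {a b : ℝ}
    (ha : 0 ≤ a) (hab : a ≤ b) (hb : ℓ < b) (hbc : b ≤ c) :
    floorLen PX γ a b = max a ℓ - a := by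
  have hcL := h.le_length
  have hℓ := h.nonneg
  have hset : {t | t ∈ Icc a b ∧ ∃ P ∈ PX, γ '' Icc t b ⊆ P} = Icc (max a ℓ) b := by
    ext t
    constructor
    · rintro ⟨ht, Q, hQ, hsub⟩
      refine ⟨max_le ht.1 ?_, ht.2⟩
      by_contra! hlt
      have hb' : b ∈ Icc 0 L := ⟨ha.trans hab, hbc.trans hcL⟩
      have hℓ' : ℓ ∈ Icc 0 L := ⟨hℓ, by linarith⟩
      have hQP : Q = P := by
        by_contra hne
        have := h.geodesic.injOn hℓ' hb' (hS.treeGraded.t1 Q hQ P h.piece hne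
          ⟨hsub ⟨ℓ, ⟨hlt.le, hb.le⟩, rfl⟩, (h.mem_iff ℓ hℓ').2 ⟨le_rfl, by linarith⟩⟩
          ⟨hsub ⟨b, ⟨by linarith, le_rfl⟩, rfl⟩, (h.mem_iff b hb').2 ⟨hb.le, hbc⟩⟩)
        exact hb.ne this
      subst hQP
      have := (h.mem_iff t ⟨ha.trans ht.1, by linarith⟩).1 (hsub ⟨t, ⟨le_rfl, ht.2⟩, rfl⟩)
      linarith [this.1]
    · rintro ⟨ht, htb⟩
      refine ⟨⟨(le_max_left _ _).trans ht, htb⟩, P, h.piece, ?_⟩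
      rintro _ ⟨u, hu, rfl⟩
      have hℓu : ℓ ≤ u := (le_max_right _ _).trans (ht.trans hu.1)
      exact (h.mem_iff u ⟨hℓ.trans hℓu, by linarith [hu.2]⟩).2 ⟨hℓu, hu.2.trans hbc⟩
  rw [floorLen, hset, csInf_Icc (max_le hab hb.le)]

/-- The color of the endpoint of a branch is determined by the color of its exit point from `P`
and by the part of the branch before `P`. -/
theorem colorValue_eq (h : IsBranch PX r xhat proj cP P σ ℓ γ c L)
    (hS : ColoringSetup X PX n r fr xhat proj cP) {v : Fin (n + 1)}
    (hv : ColorValue PX r fr xhat proj cP γ L v) :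
    (v : ℕ) = ((cP P (proj P (γ L)) : ℕ) +
      ((∑ᶠ Q ∈ {Q | (Q ∈ PX ∧ cP Q (proj Q (σ ℓ)) ≠ 0) ∧ Q ≠ P}, (cP Q (proj Q (σ ℓ)) : ℕ)) +
        ∑ᶠ p ∈ isolatedIntervals (betaSet PX r xhat proj cP σ ℓ ∪ Icc ℓ (ℓ + r / 2)),
          if p.2 ≤ ℓ then ⌊floorLen PX σ p.1 p.2 / (99 * fr)⌋₊
          else ⌊(max p.1 ℓ - p.1) / (99 * fr)⌋₊)) % (n + 1) := by
  classical
  obtain ⟨Ps, k, a, b, hPs, hab, hunion, hsep, hval⟩ := hv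
  have hr := hS.rpos
  have hrf := hS.rlefr
  have hadd := h.add_le
  have hlt := h.length_lt
  have hℓ := h.nonneg
  have hmemPs : ∀ Q, Q ∈ Ps ↔ Q ∈ PX ∧ cP Q (proj Q (γ L)) ≠ 0 := fun Q => by
    rw [← Finset.mem_coe, hPs]; rfl
  have hpieces : Ps.sum (fun Q => (cP Q (proj Q (γ L)) : ℕ)) = (cP P (proj P (γ L)) : ℕ) +
      ∑ᶠ Q ∈ {Q | (Q ∈ PX ∧ cP Q (proj Q (σ ℓ)) ≠ 0) ∧ Q ≠ P}, (cP Q (proj Q (σ ℓ)) : ℕ) := by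
    have hset : {Q | (Q ∈ PX ∧ cP Q (proj Q (σ ℓ)) ≠ 0) ∧ Q ≠ P} =
        ((Ps.erase P : Finset (Set X)) : Set (Set X)) := by
      ext Q
      rw [Finset.mem_coe, Finset.mem_erase, hmemPs, and_comm (a := Q ≠ P)]
      exact and_congr_left fun hQP => and_congr_right fun hQ => by rw [h.color_eq hS hQ hQP]
    rw [finsum_mem_congr (t := _) hset fun _ _ => rfl, finsum_mem_coe_finset]
    have hsum : ∑ Q ∈ Ps.erase P, (cP Q (proj Q (σ ℓ)) : ℕ) =
        ∑ Q ∈ Ps.erase P, (cP Q (proj Q (γ L)) : ℕ) := by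
      refine Finset.sum_congr rfl fun Q hQ => ?_
      rw [Finset.mem_erase, hmemPs] at hQ
      rw [h.color_eq hS hQ.2.1 hQ.1]
    rw [hsum]
    by_cases hP : P ∈ Ps
    · exact (Finset.add_sum_erase Ps (fun Q => (cP Q (proj Q (γ L)) : ℕ)) hP).symm
    · have h0 : cP P (proj P (γ L)) = 0 := by
        by_contra hne
        exact hP ((hmemPs P).2 ⟨h.piece, hne⟩)
      rw [Finset.erase_eq_of_notMem hP, h0]
      simp
  have hS0 : betaSet PX r xhat proj cP σ ℓ ∪ Icc ℓ (ℓ + r / 2) ⊆ Icc 0 (ℓ + r / 2) := by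
    rintro t (ht | ht)
    · exact ⟨ht.1.1, by linarith [ht.1.2]⟩
    · exact ⟨hℓ.trans ht.1, ht.2⟩
  rw [h.betaSet_eq hS] at hunion
  have hbeta := sum_components_union_Icc hab hsep (hS0.trans Icc_subset_Iic_self)
    (by linarith : ℓ + r / 2 < c) hunion (fun u v => ⌊floorLen PX γ u v / (99 * fr)⌋₊)
    (fun u v => if v ≤ ℓ then ⌊floorLen PX σ u v / (99 * fr)⌋₊
      else ⌊(max u ℓ - u) / (99 * fr)⌋₊)
    (by
      intro u v hcu huv hvL
      have := floorLen_le (γ := γ) hS.treeGraded huv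
      rw [Nat.floor_eq_zero, div_lt_one (by linarith)]
      linarith)
    (by
      intro u v huv hsub
      have hu := hS0 (hsub ⟨le_rfl, huv⟩)
      have hv := hS0 (hsub ⟨huv, le_rfl⟩)
      split_ifs with hvℓ
      · simp only [h.floorLen_of_le hu.1 hvℓ]
      · simp only [h.floorLen_of_gt hS hu.1 huv (not_le.1 hvℓ) (by linarith [hv.2])])
  rw [hval, hpieces, hbeta, add_assoc]

end IsBranch

/-- Points which project outside of `𝔠_P` and are close to `P` have the same `c*`-color only if
their projections have the same `c_P`-color. -/
theorem ColoringSetup.color_proj_eq (hS : ColoringSetup X PX n r fr xhat proj cP)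
    {cX : X → Fin (n + 1)}
    (hcX : ∀ (γ : ℝ → X) (L : ℝ), 0 ≤ L → IsGeodesicSegment γ 0 L → γ 0 = xhat →
      ColorValue PX r fr xhat proj cP γ L (cX (γ L)))
    {P : Set X} (hP : P ∈ PX) {z z' : X} (hz : proj P z ∉ pieceComp r xhat proj cP P)
    (hd : dist z (proj P z) < r) (hz' : proj P z' ∉ pieceComp r xhat proj cP P)
    (hd' : dist z' (proj P z') < r) (hzz' : cX z = cX z') :
    cP P (proj P z) = cP P (proj P z') := by
  obtain ⟨σ, hσ, hσ0, hσ1⟩ := hS.geodesic xhat (proj P xhat)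
  obtain ⟨γ, c, L, rfl, h⟩ := hS.exists_isBranch hP hσ hσ0 hσ1 hz hd
  obtain ⟨γ', c', L', rfl, h'⟩ := hS.exists_isBranch hP hσ hσ0 hσ1 hz' hd'
  have e := h.colorValue_eq hS
    (hcX γ L (h.nonneg.trans (h.length_nonneg hS).2) h.geodesic h.start)
  have e' := h'.colorValue_eq hS
    (hcX γ' L' (h'.nonneg.trans (h'.length_nonneg hS).2) h'.geodesic h'.start)
  rw [hzz', e'] at e
  have := Nat.ModEq.add_right_cancel' _ e
  rw [Nat.ModEq, Nat.mod_eq_of_lt (Fin.is_lt _), Nat.mod_eq_of_lt (Fin.is_lt _)] at this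
  exact Fin.ext this.symm

/-- Monochromatic `r`-chains in a piece have diameter at most `8 f(r)`. -/
theorem ColoringSetup.dist_le_of_chain (hS : ColoringSetup X PX n r fr xhat proj cP)
    {P : Set X} (hP : P ∈ PX) {m : ℕ} {w : ℕ → X} (hw : ∀ i ≤ m, w i ∈ P)
    (hd : ∀ i < m, dist (w i) (w (i + 1)) < r)
    (hc : ∀ i ≤ m, cP P (w i) = cP P (w 0)) : dist (w 0) (w m) ≤ 8 * fr := by
  have hfr : 0 < fr := hS.rpos.trans_le hS.rlefr
  have hchain : IsDChain dist r {z | z ∈ P ∧ cP P z = cP P (w 0)} (w 0) (w m) :=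
    ⟨m, w, rfl, rfl, fun i hi => ⟨hw i hi, hc i hi⟩, hd⟩
  by_cases h0 : cP P (w 0) = 0
  · rw [h0] at hchain
    exact hS.zeroBounded P hP _ _ hchain
  · linarith [hS.nonzeroBounded P hP _ h0 _ _ hchain]

theorem ColoringSetup.dist_base_le (hS : ColoringSetup X PX n r fr xhat proj cP)
    {P : Set X} (hP : P ∈ PX) {m : ℕ} {w : ℕ → X} (hw : ∀ i ≤ m, w i ∈ P)
    (hd : ∀ i < m, dist (w i) (w (i + 1)) < r)
    (hc : ∀ i ≤ m, ∀ j ≤ m, w i ∉ pieceComp r xhat proj cP P →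
      w j ∉ pieceComp r xhat proj cP P → cP P (w i) = cP P (w j))
    (hmeet : ∃ i ≤ m, w i ∈ pieceComp r xhat proj cP P) :
    dist (w 0) (proj P xhat) ≤ 17 * fr := by
  classical
  have hrf := hS.rlefr
  have hr := hS.rpos
  obtain ⟨hkm, hk⟩ := Nat.find_spec hmeet
  have hmin : ∀ i < Nat.find hmeet, w i ∉ pieceComp r xhat proj cP P := fun i hi hi' =>
    Nat.find_min hmeet hi ⟨hi.le.trans hkm, hi'⟩
  have hcomp := hS.zeroBounded P hP _ _ hk
  rcases hk0 : Nat.find hmeet with _ | k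
  · rw [hk0, dist_comm] at hcomp
    linarith
  · rw [hk0, dist_comm] at hcomp
    rw [hk0] at hkm hmin
    have h1 := hS.dist_le_of_chain hP (m := k) (fun i hi => hw i (by omega))
      (fun i hi => hd i (by omega)) fun i hi => hc i (by omega) 0 (by omega)
        (hmin i (by omega)) (hmin 0 (by omega))
    have h2 := hd k (by omega)
    linarith [dist_triangle4 (w 0) (w k) (w (k + 1)) (proj P xhat)]

end Coloring

/-- In the Setup, if two points `x` and `y` of a piece `P` have the same `c*_X`-color
and can be connected by an `r`-chain of that `c*_X`-color in `X`, then
`d(x, y) ≤ 36·f(r)`. -/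
theorem rComponent_in_piece_bounded (X : Type*) [MetricSpace X] [CompleteSpace X]
    (PX : Set (Set X)) (n : ℕ) (r fr : ℝ) (xhat : X)
    (proj : Set X → X → X) (cP : Set X → X → Fin (n + 1))
    (hsetup : ColoringSetup X PX n r fr xhat proj cP)
    (cX : X → Fin (n + 1))
    (hcX : ∀ (γ : ℝ → X) (L : ℝ), 0 ≤ L → IsGeodesicSegment γ 0 L → γ 0 = xhat →
      ColorValue PX r fr xhat proj cP γ L (cX (γ L)))
    (P : Set X) (hP : P ∈ PX) (x y : X) (hx : x ∈ P) (hy : y ∈ P)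
    (hcolor : cX x = cX y)
    (hchain : IsDChain dist r {z : X | cX z = cX x} x y) :
    dist x y ≤ 36 * fr := by
  have hT := hsetup.treeGraded
  have hG := hsetup.geodesic
  have hr := hsetup.rpos
  have hrf := hsetup.rlefr
  have hN := hsetup.isNearest hP
  obtain ⟨m, z, hz0, hzm, hzc, hzd⟩ := hchain
  have hw0 : proj P (z 0) = x := by rw [hz0, (hN x).eq_self hx]
  have hwm : proj P (z m) = y := by rw [hzm, (hN y).eq_self hy]
  have hwd : ∀ i < m, dist (proj P (z i)) (proj P (z (i + 1))) < r := fun i hi =>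
    (dist_proj_le hT hG hP hN _ _).trans_lt (hzd i hi)
  -- every projected point is the projection of a nearby point of the same color
  have hnear : ∀ i ≤ m, ∃ u, cX u = cX x ∧ proj P u = proj P (z i) ∧ dist u (proj P u) < r := by
    intro i
    induction i with
    | zero => exact fun _ => ⟨x, rfl, by rw [hz0], by rwa [(hN x).eq_self hx, dist_self]⟩
    | succ i ih =>
      intro hi
      by_cases hne : proj P (z i) = proj P (z (i + 1))
      · rw [← hne]
        exact ih (by omega)
      · refine ⟨z (i + 1), hzc _ hi, rfl, ?_⟩
        have h1 := dist_eq_of_proj_ne hT hG hP hN hne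
        have h2 := hzd i (by omega)
        rw [dist_comm (z (i + 1))]
        linarith [dist_nonneg (x := z i) (y := proj P (z i)),
          dist_nonneg (x := proj P (z i)) (y := proj P (z (i + 1)))]
  have hc : ∀ i ≤ m, ∀ j ≤ m, proj P (z i) ∉ pieceComp r xhat proj cP P →
      proj P (z j) ∉ pieceComp r xhat proj cP P →
      cP P (proj P (z i)) = cP P (proj P (z j)) := by
    intro i hi j hj hi' hj'
    obtain ⟨u, huc, hu, hud⟩ := hnear i hi
    obtain ⟨v, hvc, hv, hvd⟩ := hnear j hj
    rw [← hu] at hi' ⊢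
    rw [← hv] at hj' ⊢
    exact hsetup.color_proj_eq hcX hP hi' hud hj' hvd (huc.trans hvc.symm)
  by_cases hmeet : ∃ i ≤ m, proj P (z i) ∈ pieceComp r xhat proj cP P
  · have h1 := hsetup.dist_base_le hP (w := fun i => proj P (z i)) (fun i _ => (hN _).1) hwd hc
      hmeet
    have h2 := hsetup.dist_base_le hP (m := m) (w := fun i => proj P (z (m - i)))
      (fun i _ => (hN _).1)
      (fun i hi => by
        have := hwd (m - (i + 1)) (by omega)
        rwa [show m - (i + 1) + 1 = m - i by omega, dist_comm] at this)
      (fun i _ j _ => hc _ (Nat.sub_le _ _) _ (Nat.sub_le _ _))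
      (by
        obtain ⟨i, hi, hmem⟩ := hmeet
        exact ⟨m - i, Nat.sub_le _ _, by rwa [Nat.sub_sub_self hi]⟩)
    simp only [Nat.sub_zero, hw0, hwm] at h1 h2
    linarith [dist_triangle_right x y (proj P xhat)]
  · push Not at hmeet
    have := hsetup.dist_le_of_chain hP (w := fun i => proj P (z i)) (fun i _ => (hN _).1) hwd
      fun i hi => hc i hi 0 (Nat.zero_le _) (hmeet i hi) (hmeet 0 (Nat.zero_le _))
    simp only [hw0, hwm] at this
    linarith
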